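/- arXiv:1403.2557 — 3 statements merged into one kernel-verified Lean document; each statement's English description precedes it below -/
import Mathlib

section
/- Let 0 < e < 1/2 be a real number and let (r_l)_{l≥2} be natural numbers satisfying r_l ≤ e²·(2−2e)^{l−2} for all l ≥ 2. Let J be a two-sided ideal of A = K⟨x,y⟩ generated by homogeneous elements of degrees ≥ 2, with exactly s_n generators of degree n, where s_n ≤ r_n for each n ≥ 2. Then for every m ≥ 2, dim_K ( A(m) / (J ∩ A(m)) ) > r_m − s_m. -/
open TensorProduct

noncomputable section

/-- The free associative unital `K`-algebra on two generators `x, y`. -/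
abbrev FA (K : Type) [Field K] : Type := FreeAlgebra K (Fin 2)

/-- `gp K n` is `A(n)`, the span of the words of length `n` in the two generators. -/
def gp (K : Type) [Field K] (n : ℕ) : Submodule K (FA K) :=
  Submodule.span K {a : FA K | ∃ w : List (Fin 2), w.length = n ∧ a = (w.map (FreeAlgebra.ι K)).prod}

/-- The two-sided ideal of `A` generated by the set `S`, as a `K`-subspace:
the span of all products `u * s * v` with `s ∈ S`. -/
def idealGen (K : Type) [Field K] (S : Set (FA K)) : Submodule K (FA K) :=
  ⊤ * Submodule.span K S * ⊤

/-- The word basis of the free algebra, evaluated at a word. -/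
lemma basisFreeMonoid_apply (K : Type) [Field K] (w : List (Fin 2)) :
    FreeAlgebra.basisFreeMonoid K (Fin 2) (FreeMonoid.ofList w) =
      (w.map (FreeAlgebra.ι K)).prod := by
  simp only [FreeAlgebra.basisFreeMonoid, Module.Basis.map_apply, Finsupp.coe_basisSingleOne]
  change FreeAlgebra.equivMonoidAlgebraFreeMonoid.symm
    (MonoidAlgebra.single (FreeMonoid.ofList w) (1 : K)) = _
  simp [FreeAlgebra.equivMonoidAlgebraFreeMonoid, FreeMonoid.lift_apply]

lemma gp_mul_gp (K : Type) [Field K] (m n : ℕ) : gp K m * gp K n = gp K (m + n) := by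
  rw [gp, gp, gp, Submodule.span_mul_span]
  congr 1
  ext a
  constructor
  · rintro ⟨_, ⟨u, rfl, rfl⟩, _, ⟨v, rfl, rfl⟩, rfl⟩
    exact ⟨u ++ v, by simp, by simp⟩
  · rintro ⟨w, hw, rfl⟩
    refine ⟨_, ⟨w.take m, by simp; omega, rfl⟩, _, ⟨w.drop m, by simp; omega, rfl⟩, ?_⟩
    simp only
    rw [← List.prod_append, ← List.map_append, List.take_append_drop]

lemma gp_zero (K : Type) [Field K] : gp K 0 = 1 := by
  rw [gp, Submodule.one_eq_span]
  congr 1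
  ext a
  simp

lemma gp_eq_span_range (K : Type) [Field K] (n : ℕ) :
    gp K n = Submodule.span K (Set.range fun w : List.Vector (Fin 2) n =>
      FreeAlgebra.basisFreeMonoid K (Fin 2) (FreeMonoid.ofList w.1)) := by
  rw [gp]
  congr 1
  ext a
  constructor
  · rintro ⟨w, hw, rfl⟩
    exact ⟨⟨w, hw⟩, basisFreeMonoid_apply K w⟩
  · rintro ⟨w, rfl⟩
    exact ⟨w.1, w.2, basisFreeMonoid_apply K w.1⟩

instance gp.finiteDimensional (K : Type) [Field K] (n : ℕ) : FiniteDimensional K (gp K n) := by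
  rw [gp_eq_span_range]
  exact FiniteDimensional.span_of_finite K (Set.finite_range _)

lemma finrank_gp (K : Type) [Field K] (n : ℕ) : Module.finrank K (gp K n) = 2 ^ n := by
  rw [gp_eq_span_range, finrank_span_eq_card, card_vector, Fintype.card_fin]
  exact (FreeAlgebra.basisFreeMonoid K (Fin 2)).linearIndependent.comp
    (fun w : List.Vector (Fin 2) n => FreeMonoid.ofList w.1)
    fun _ _ h => Subtype.ext (FreeMonoid.ofList.injective h)

/-- The projection of the free algebra onto its homogeneous component of degree `m`. -/
def gpProj (K : Type) [Field K] (m : ℕ) : FA K →ₗ[K] FA K :=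
  (FreeAlgebra.basisFreeMonoid K (Fin 2)).constr K fun w =>
    if w.toList.length = m then FreeAlgebra.basisFreeMonoid K (Fin 2) w else 0

lemma gpProj_of_mem {K : Type} [Field K] {n : ℕ} {z : FA K} (hz : z ∈ gp K n) (m : ℕ) :
    gpProj K m z = if n = m then z else 0 := by
  have h : gp K n ≤ LinearMap.eqLocus (gpProj K m) (if n = m then LinearMap.id else 0) := by
    rw [gp_eq_span_range, Submodule.span_le]
    rintro _ ⟨w, rfl⟩
    have hw := w.2
    rw [SetLike.mem_coe, LinearMap.mem_eqLocus, gpProj, Module.Basis.constr_basis]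
    simp only [FreeMonoid.toList_ofList, hw]
    split_ifs <;> rfl
  have h' : gpProj K m z = _ := h hz
  rw [h']
  split_ifs <;> rfl

open Pointwise in
lemma idealGen_eq_span (K : Type) [Field K] (S : Set (FA K)) :
    idealGen K S = Submodule.span K
      (Set.range (fun w : List (Fin 2) => (w.map (FreeAlgebra.ι K)).prod) * S *
        Set.range (fun w : List (Fin 2) => (w.map (FreeAlgebra.ι K)).prod)) := by
  have h : (⊤ : Submodule K (FA K)) = Submodule.span K
      (Set.range (fun w : List (Fin 2) => (w.map (FreeAlgebra.ι K)).prod)) := by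
    rw [← (FreeAlgebra.basisFreeMonoid K (Fin 2)).span_eq]
    congr 1
    ext a
    constructor
    · rintro ⟨w, rfl⟩
      exact ⟨w.toList, (basisFreeMonoid_apply K w.toList).symm⟩
    · rintro ⟨w, rfl⟩
      exact ⟨FreeMonoid.ofList w, basisFreeMonoid_apply K w⟩
  rw [idealGen, h, Submodule.span_mul_span, Submodule.span_mul_span]

/-- The homogeneous components of the two-sided ideal generated by homogeneous subspaces `G j`
of degree `j ≥ 1`, defined by splitting off the first letter of the left factor. -/
def idealComponent {K : Type} [Field K] (G : ℕ → Submodule K (FA K)) : ℕ → Submodule K (FA K)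
  | 0 => ⊥
  | m + 1 => gp K 1 * idealComponent G m ⊔
      (Finset.range (m + 2)).sup fun j => G j * gp K (m + 1 - j)

section idealComponent

variable {K : Type} [Field K] {G : ℕ → Submodule K (FA K)}

lemma idealComponent_le (hG : ∀ j, G j ≤ gp K j) (m : ℕ) : idealComponent G m ≤ gp K m := by
  induction m with
  | zero => exact bot_le
  | succ m ih =>
    refine sup_le ?_ (Finset.sup_le fun j hj => ?_)
    · rw [add_comm, ← gp_mul_gp]
      exact mul_le_mul' le_rfl ih
    · have hj' := Finset.mem_range.1 hj
      calc G j * gp K (m + 1 - j) ≤ gp K j * gp K (m + 1 - j) := mul_le_mul' (hG j) le_rfl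
        _ = gp K (m + 1) := by rw [gp_mul_gp]; congr 1; omega

lemma gp_mul_idealComponent_le (i m : ℕ) :
    gp K i * idealComponent G m ≤ idealComponent G (i + m) := by
  induction i with
  | zero => rw [gp_zero, one_mul, zero_add]
  | succ i ih =>
    rw [add_comm i 1, ← gp_mul_gp, mul_assoc, show 1 + i + m = i + m + 1 by ring]
    exact (mul_le_mul' le_rfl ih).trans le_sup_left

lemma mul_gp_le_idealComponent (h0 : G 0 = ⊥) (j b : ℕ) :
    G j * gp K b ≤ idealComponent G (j + b) := by
  cases j with
  | zero => simp [h0]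
  | succ j =>
    rw [show j + 1 + b = j + b + 1 by ring]
    refine le_trans ?_ le_sup_right
    have := Finset.le_sup (f := fun i => G i * gp K (j + b + 1 - i))
      (Finset.mem_range.2 (show j + 1 < j + b + 2 by omega))
    rwa [show j + b + 1 - (j + 1) = b by omega] at this

/-- The homogeneous part of degree `m` of the generated ideal lies in `idealComponent`. -/
lemma idealGen_inf_gp_le (hG : ∀ j, G j ≤ gp K j) (h0 : G 0 = ⊥) {S : Set (FA K)}
    (hS : ∀ a ∈ S, ∃ j, a ∈ G j) (m : ℕ) : idealGen K S ⊓ gp K m ≤ idealComponent G m := by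
  have key : idealGen K S ≤ (idealComponent G m).comap (gpProj K m) := by
    rw [idealGen_eq_span, Submodule.span_le]
    rintro _ ⟨_, ⟨_, ⟨u, rfl⟩, a, ha, rfl⟩, _, ⟨v, rfl⟩, rfl⟩
    obtain ⟨j, hj⟩ := hS a ha
    have hu : (u.map (FreeAlgebra.ι K)).prod ∈ gp K u.length :=
      Submodule.subset_span ⟨u, rfl, rfl⟩
    have hv : (v.map (FreeAlgebra.ι K)).prod ∈ gp K v.length :=
      Submodule.subset_span ⟨v, rfl, rfl⟩
    have hmem : (u.map (FreeAlgebra.ι K)).prod * a * (v.map (FreeAlgebra.ι K)).prod ∈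
        idealComponent G (u.length + (j + v.length)) := by
      rw [mul_assoc]
      exact gp_mul_idealComponent_le _ _ (Submodule.mul_mem_mul hu
        (mul_gp_le_idealComponent h0 _ _ (Submodule.mul_mem_mul hj hv)))
    simp only [SetLike.mem_coe, Submodule.mem_comap]
    rw [gpProj_of_mem (idealComponent_le hG _ hmem)]
    split_ifs with h
    · exact h ▸ hmem
    · exact zero_mem _
  rintro z ⟨hz, hzm⟩
  have h := key hz
  rwa [Submodule.mem_comap, gpProj_of_mem hzm, if_pos rfl] at h

end idealComponent

lemma finrank_mul_submodule_le {K : Type} [Field K] (M N : Submodule K (FA K))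
    [FiniteDimensional K M] [FiniteDimensional K N] :
    Module.finrank K ↥(M * N) ≤ Module.finrank K M * Module.finrank K N := by
  rw [← Submodule.mulMap_range, ← Module.finrank_tensorProduct (R := K)]
  exact LinearMap.finrank_range_le _

lemma finrank_finset_sup_le {K V ι : Type*} [Field K] [AddCommGroup V] [Module K V]
    (s : Finset ι) (f : ι → Submodule K V) [∀ i, FiniteDimensional K (f i)] :
    Module.finrank K ↥(s.sup f) ≤ ∑ i ∈ s, Module.finrank K (f i) := by
  classical
  induction s using Finset.induction_on with
  | empty => simp
  | insert a s ha ih =>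
    rw [Finset.sup_insert, Finset.sum_insert ha]
    exact (Submodule.finrank_add_le_finrank_add_finrank _ _).trans (by gcongr)

/-- The Golod–Shafarevich recursion for the codimensions of the ideal components. -/
lemma finrank_idealComponent_succ_le {K : Type} [Field K] {G : ℕ → Submodule K (FA K)}
    (hG : ∀ j, G j ≤ gp K j) (h0 : G 0 = ⊥) (m : ℕ) :
    Module.finrank K (idealComponent G (m + 1)) ≤ 2 * Module.finrank K (idealComponent G m) +
      ∑ j ∈ Finset.range (m + 2), Module.finrank K (G j) *
        (Module.finrank K (gp K (m + 1 - j)) -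
          Module.finrank K (idealComponent G (m + 1 - j))) := by
  have hcompl : ∀ k, ∃ C : Submodule K (FA K),
      Disjoint (idealComponent G k) C ∧ idealComponent G k ⊔ C = gp K k := fun k =>
    IsModularLattice.exists_disjoint_and_sup_eq (idealComponent_le hG k)
  choose C hdisj hsup using hcompl
  have fdI : ∀ k, FiniteDimensional K (idealComponent G k) := fun k =>
    Submodule.finiteDimensional_of_le (idealComponent_le hG k)
  have fdG : ∀ k, FiniteDimensional K (G k) := fun k =>
    Submodule.finiteDimensional_of_le (hG k)
  have fdC : ∀ k, FiniteDimensional K (C k) := fun k =>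
    Submodule.finiteDimensional_of_le (le_sup_right.trans (hsup k).le)
  have hC : ∀ k, Module.finrank K (C k) =
      Module.finrank K (gp K k) - Module.finrank K (idealComponent G k) := fun k => by
    have h := Submodule.finrank_sup_add_finrank_inf_eq (idealComponent G k) (C k)
    rw [hsup, (hdisj k).eq_bot, finrank_bot] at h
    omega
  have hle : idealComponent G (m + 1) ≤ gp K 1 * idealComponent G m ⊔
      (Finset.range (m + 2)).sup fun j => G j * C (m + 1 - j) := by
    refine sup_le le_sup_left (Finset.sup_le fun j hj => ?_)
    rw [← hsup, Submodule.mul_sup]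
    refine sup_le ?_ (le_sup_of_le_right
      (Finset.le_sup (f := fun j => G j * C (m + 1 - j)) hj))
    refine le_sup_of_le_left ?_
    cases j with
    | zero => simp [h0]
    | succ j =>
      have hj' := Finset.mem_range.1 hj
      calc G (j + 1) * idealComponent G (m + 1 - (j + 1))
          ≤ gp K (1 + j) * idealComponent G (m - j) := by
            rw [add_comm j 1, show m + 1 - (1 + j) = m - j by omega]
            exact mul_le_mul' (hG _) le_rfl
        _ = gp K 1 * (gp K j * idealComponent G (m - j)) := by rw [← gp_mul_gp, mul_assoc]
        _ ≤ gp K 1 * idealComponent G (j + (m - j)) :=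
            mul_le_mul' le_rfl (gp_mul_idealComponent_le _ _)
        _ = gp K 1 * idealComponent G m := by congr 2; omega
  have fdM : ∀ M N : Submodule K (FA K), FiniteDimensional K M → FiniteDimensional K N →
      FiniteDimensional K ↥(M * N) := fun M N _ _ => by
    rw [← Submodule.mulMap_range]; infer_instance
  have fd1 := fdM (gp K 1) (idealComponent G m) inferInstance inferInstance
  have fd2 : ∀ j, FiniteDimensional K ↥(G j * C (m + 1 - j)) := fun j =>
    fdM _ _ inferInstance inferInstance
  have fd3 : FiniteDimensional K
      ↥((Finset.range (m + 2)).sup fun j => G j * C (m + 1 - j)) :=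
    Submodule.finiteDimensional_finset_sup _ _
  calc _ ≤ _ := Submodule.finrank_mono hle
    _ ≤ _ := Submodule.finrank_add_le_finrank_add_finrank _ _
    _ ≤ _ := add_le_add (finrank_mul_submodule_le _ _)
      ((finrank_finset_sup_le _ _).trans
        (Finset.sum_le_sum fun j _ => finrank_mul_submodule_le _ _))
    _ = _ := by simp only [hC, finrank_gp, pow_one]

/-- A nonnegative sequence satisfying the Golod–Shafarevich recursion grows at least like
`(2 - e) ^ n`. -/
lemma pow_le_of_golodShafarevich {e : ℝ} (he₀ : 0 < e) (he : e < 1 / 2) {s : ℕ → ℝ}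
    {d : ℕ → ℝ} (hs : ∀ l, s (l + 2) ≤ e ^ 2 * (2 - 2 * e) ^ l) (hs0 : s 0 = 0) (hs1 : s 1 = 0)
    (hd : ∀ n, 0 ≤ d n) (hd0 : d 0 = 1)
    (hrec : ∀ m, 2 * d m ≤ d (m + 1) + ∑ j ∈ Finset.range (m + 2), s j * d (m + 1 - j)) (n : ℕ) :
    (2 - e) ^ n ≤ d n := by
  set T : ℕ → ℝ := fun m => ∑ i ∈ Finset.range m, (2 - 2 * e) ^ i * d (m - 1 - i) with hT
  have hTsucc : ∀ m, T (m + 1) = d m + (2 - 2 * e) * T m := fun m => by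
    simp only [hT]
    rw [Finset.sum_range_succ', Finset.mul_sum, add_comm]
    congr 1
    · simp
    · refine Finset.sum_congr rfl fun i _ => ?_
      rw [show m + 1 - 1 - (i + 1) = m - 1 - i by omega]
      ring
  have hsum : ∀ m, ∑ j ∈ Finset.range (m + 2), s j * d (m + 1 - j) ≤ e ^ 2 * T m := fun m => by
    rw [Finset.sum_range_succ', Finset.sum_range_succ', hs0, hs1, zero_mul, zero_mul, add_zero,
      add_zero]
    simp only [hT, Finset.mul_sum]
    refine Finset.sum_le_sum fun i _ => ?_
    rw [show m + 1 - (i + 1 + 1) = m - 1 - i by omega, ← mul_assoc]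
    exact mul_le_mul_of_nonneg_right (hs i) (hd _)
  have hstep : ∀ m, e * T m ≤ d m → (2 - e) * d m ≤ d (m + 1) := fun m h => by
    have h1 := hrec m
    have h2 := hsum m
    nlinarith
  have hinv : ∀ m, e * T m ≤ d m := fun m => by
    induction m with
    | zero => simp [hT, hd0]
    | succ m ih =>
      have h := hstep m ih
      rw [hTsucc]
      nlinarith
  induction n with
  | zero => simp [hd0]
  | succ n ih =>
    calc (2 - e) ^ (n + 1) = (2 - e) * (2 - e) ^ n := pow_succ' _ _
      _ ≤ (2 - e) * d n := mul_le_mul_of_nonneg_left ih (by linarith)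
      _ ≤ d (n + 1) := hstep n (hinv n)

/-- Golod–Shafarevich type bound: if `r_l ≤ e²(2−2e)^{l−2}` and `J` is generated by
`s_n ≤ r_n` homogeneous elements of each degree `n ≥ 2`, then
`dim A(m)/(J ∩ A(m)) > r_m − s_m` for every `m ≥ 2`. -/
theorem statement5 (K : Type) [Field K] (e : ℝ) (he₀ : 0 < e) (he : e < 1 / 2)
    (r s : ℕ → ℕ) (hr : ∀ l, 2 ≤ l → (r l : ℝ) ≤ e ^ 2 * (2 - 2 * e) ^ (l - 2))
    (hs : ∀ n, s n ≤ r n) (hs0 : s 0 = 0) (hs1 : s 1 = 0)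
    (g : (n : ℕ) → Fin (s n) → FA K) (hg : ∀ n i, g n i ∈ gp K n) :
    ∀ m, 2 ≤ m →
      (r m - s m : ℕ) < Module.finrank K
        (↥(gp K m) ⧸ Submodule.comap (gp K m).subtype
          (idealGen K (⋃ n : ℕ, Set.range (g n)))) := by
  intro m hm
  set G : ℕ → Submodule K (FA K) := fun n => Submodule.span K (Set.range (g n)) with hGdef
  have hG : ∀ j, G j ≤ gp K j := fun j => by
    rw [hGdef, Submodule.span_le]
    rintro _ ⟨i, rfl⟩
    exact hg j i
  have hGs : ∀ j, Module.finrank K (G j) ≤ s j := fun j => 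
    (finrank_range_le_card (R := K) (g j)).trans (Fintype.card_fin _).le
  have h0 : G 0 = ⊥ := by
    have : IsEmpty (Fin (s 0)) := by rw [hs0]; infer_instance
    simp [hGdef, Set.range_eq_empty]
  have fdI : ∀ k, FiniteDimensional K (idealComponent G k) := fun k =>
    Submodule.finiteDimensional_of_le (idealComponent_le hG k)
  have hIle : ∀ k, Module.finrank K (idealComponent G k) ≤ Module.finrank K (gp K k) := fun k =>
    Submodule.finrank_mono (idealComponent_le hG k)
  have hgrow : (2 - e) ^ m ≤ (((Module.finrank K (gp K m) -
      Module.finrank K (idealComponent G m) : ℕ)) : ℝ) := by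
    refine pow_le_of_golodShafarevich he₀ he (s := fun j => (s j : ℝ))
      (d := fun k => ((Module.finrank K (gp K k) -
        Module.finrank K (idealComponent G k) : ℕ) : ℝ)) (fun l => ?_) (by simp [hs0])
      (by simp [hs1]) (fun n => Nat.cast_nonneg _) ?_ (fun k => ?_) m
    · exact (Nat.cast_le.2 (hs _)).trans (hr (l + 2) (by omega))
    · rw [finrank_gp, idealComponent, finrank_bot]
      simp
    · have h := finrank_idealComponent_succ_le hG h0 k
      have h' := h.trans (Nat.add_le_add_left
        (Finset.sum_le_sum fun j _ => Nat.mul_le_mul_right _ (hGs j)) _)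
      have h1 := hIle k
      have h2 := hIle (k + 1)
      have h3 : Module.finrank K (gp K (k + 1)) = 2 * Module.finrank K (gp K k) := by
        rw [finrank_gp, finrank_gp, pow_succ']
      exact_mod_cast (by omega : 2 * (Module.finrank K (gp K k) -
        Module.finrank K (idealComponent G k)) ≤ _)
  have hcomap : Module.finrank K (Submodule.comap (gp K m).subtype
      (idealGen K (⋃ n : ℕ, Set.range (g n)))) ≤ Module.finrank K (idealComponent G m) := by
    rw [← Submodule.finrank_map_subtype_eq, Submodule.map_comap_subtype, inf_comm]
    refine Submodule.finrank_mono (idealGen_inf_gp_le hG h0 (fun a ha => ?_) m)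
    obtain ⟨n, hn⟩ := Set.mem_iUnion.1 ha
    exact ⟨n, Submodule.subset_span hn⟩
  have hquot := Submodule.finrank_quotient_add_finrank (Submodule.comap (gp K m).subtype
      (idealGen K (⋃ n : ℕ, Set.range (g n))))
  have hlt : (r m : ℝ) < (2 - e) ^ m := by
    obtain ⟨l, rfl⟩ := Nat.exists_eq_add_of_le' hm
    calc (r (l + 2) : ℝ) ≤ e ^ 2 * (2 - 2 * e) ^ l := hr (l + 2) hm
      _ ≤ e ^ 2 * (2 - e) ^ l := by
        gcongr <;> linarith
      _ < (2 - e) ^ 2 * (2 - e) ^ l := by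
        have : 0 < (2 - e) ^ l := pow_pos (by linarith) l
        gcongr
        linarith
      _ = (2 - e) ^ (l + 2) := by ring
  have hnat := Nat.cast_lt.1 (hlt.trans_le hgrow)
  omega
end
end

section
/- Let t ≥ 1 and let f ∈ ∑_{1≤i,j≤t} A(i) ⊗ A(j) ⊆ A ⊗_K A. For each natural number n > t there exists a K-subspace F ⊆ A(n) ⊗ (∑_{i : n/(2t) ≤ i ≤ 2tn} A(i)) with dim_K F ≤ 2^{2t+1}·t·n such that, for every integer m ≥ n, f^m belongs to the right ideal of A ⊗_K A generated by the set of all products h·g·f^{m−n} with h ∈ F and g ∈ (∑_{i=0}^{t} A(i)) ⊗ K·1. -/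
open TensorProduct

noncomputable section

/-- The canonical image of `U ⊗[K] V` inside `A ⊗[K] A`. -/
def tp (K : Type) [Field K] (U V : Submodule K (FA K)) : Submodule K (FA K ⊗[K] FA K) :=
  Submodule.map₂ (TensorProduct.mk K (FA K) (FA K)) U V

/-- `∑_{i=lo}^{hi} A(i)`. -/
def sumGp (K : Type) [Field K] (lo hi : ℕ) : Submodule K (FA K) :=
  ⨆ i ∈ Finset.Icc lo hi, gp K i

/-- `∑_{i : n/(2t) ≤ i ≤ 2tn} A(i)` (the condition `n/(2t) ≤ i` is encoded as `n ≤ 2ti`). -/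
def midGp (K : Type) [Field K] (t n : ℕ) : Submodule K (FA K) :=
  ⨆ i ∈ {i : ℕ | n ≤ 2 * t * i ∧ i ≤ 2 * t * n}, gp K i

/-- The right ideal of `A ⊗[K] A` generated by a set `X`: the span of `X·(A ⊗ A)`. -/
def rIdeal (K : Type) [Field K] (X : Set (FA K ⊗[K] FA K)) :
    Submodule K (FA K ⊗[K] FA K) :=
  Submodule.span K X * ⊤

theorem mul_gp_le (K : Type) [Field K] (i j : ℕ) : gp K i * gp K j ≤ gp K (i + j) := by
  unfold gp
  rw [Submodule.span_mul_span]
  refine Submodule.span_mono ?_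
  rintro _ ⟨_, ⟨v, rfl, rfl⟩, _, ⟨w, rfl, rfl⟩, rfl⟩
  exact ⟨v ++ w, by simp, by simp⟩

theorem gp_le_sumGp (K : Type) [Field K] {lo hi i : ℕ} (h₁ : lo ≤ i) (h₂ : i ≤ hi) :
    gp K i ≤ sumGp K lo hi :=
  le_iSup₂_of_le (f := fun i (_ : i ∈ Finset.Icc lo hi) => gp K i) i
    (Finset.mem_Icc.2 ⟨h₁, h₂⟩) le_rfl

theorem sumGp_le (K : Type) [Field K] {lo hi : ℕ} {S : Submodule K (FA K)}
    (h : ∀ i, lo ≤ i → i ≤ hi → gp K i ≤ S) : sumGp K lo hi ≤ S :=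
  iSup₂_le fun i hi => h i (Finset.mem_Icc.1 hi).1 (Finset.mem_Icc.1 hi).2

theorem sumGp_eq_bot (K : Type) [Field K] {lo hi : ℕ} (h : hi < lo) : sumGp K lo hi = ⊥ :=
  le_bot_iff.1 (sumGp_le K fun _ _ _ => by omega)

theorem sumGp_mul_sumGp_le (K : Type) [Field K] (a b c d : ℕ) :
    sumGp K a b * sumGp K c d ≤ sumGp K (a + c) (b + d) := by
  conv_lhs => unfold sumGp
  simp only [Submodule.iSup_mul, Submodule.mul_iSup, iSup_le_iff, Finset.mem_Icc]
  intro j hj i hi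
  exact (mul_gp_le K i j).trans (gp_le_sumGp K (by omega) (by omega))

theorem tp_mono (K : Type) [Field K] {U U' V V' : Submodule K (FA K)} (hU : U ≤ U')
    (hV : V ≤ V') : tp K U V ≤ tp K U' V' :=
  Submodule.map₂_le_map₂ hU hV

theorem tmul_mem_tp (K : Type) [Field K] {U V : Submodule K (FA K)} {u v : FA K} (hu : u ∈ U)
    (hv : v ∈ V) : u ⊗ₜ[K] v ∈ tp K U V :=
  Submodule.apply_mem_map₂ _ hu hv

theorem tp_mul_tp_le (K : Type) [Field K] (U V U' V' : Submodule K (FA K)) :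
    tp K U V * tp K U' V' ≤ tp K (U * U') (V * V') := by
  conv_lhs => simp only [tp, Submodule.map₂_eq_span_image2]
  rw [Submodule.span_mul_span, Submodule.span_le]
  rintro _ ⟨_, ⟨u, hu, v, hv, rfl⟩, _, ⟨u', hu', v', hv', rfl⟩, rfl⟩
  simp only [TensorProduct.mk_apply, Algebra.TensorProduct.tmul_mul_tmul]
  exact tmul_mem_tp K (Submodule.mul_mem_mul hu hu') (Submodule.mul_mem_mul hv hv')

theorem one_mem_gp_zero (K : Type) [Field K] : (1 : FA K) ∈ gp K 0 :=
  Submodule.subset_span ⟨[], rfl, by simp⟩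

/-- The word formed by the first `w.1` letters of `w.2`; every word of length less than `t` has
this form. -/
def shortWord (K : Type) [Field K] (t : ℕ) (w : Fin t × (Fin t → Fin 2)) : FA K :=
  (((List.ofFn w.2).take w.1).map (FreeAlgebra.ι K)).prod

theorem shortWord_mem (K : Type) [Field K] (t : ℕ) (w : Fin t × (Fin t → Fin 2)) :
    shortWord K t w ∈ sumGp K 0 t :=
  gp_le_sumGp K (Nat.zero_le _) w.1.2.le
    (Submodule.subset_span ⟨_, by simp [w.1.2.le], rfl⟩)

theorem exists_shortWord_eq (K : Type) [Field K] (t : ℕ) (v : List (Fin 2)) (hv : v.length < t) :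
    ∃ w, shortWord K t w = (v.map (FreeAlgebra.ι K)).prod := by
  refine ⟨(⟨v.length, hv⟩, fun i => v.getD i 0), ?_⟩
  unfold shortWord
  congr 2
  apply List.ext_getElem
  · simp [hv.le]
  · intro i h₁ h₂
    simp [h₂]

theorem tp_gp_add_le (K : Type) [Field K] (t n r : ℕ) (hr : r < t) (V : Submodule K (FA K)) :
    tp K (gp K (n + r)) V ≤
      ⨆ w, tp K (gp K n) V * Submodule.span K {shortWord K t w ⊗ₜ[K] (1 : FA K)} := by
  conv_lhs => rw [tp, gp, ← Submodule.span_eq V, Submodule.map₂_span_span]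
  rw [Submodule.span_le]
  rintro _ ⟨_, ⟨v, hv, rfl⟩, b, hb, rfl⟩
  obtain ⟨w, hw⟩ := exists_shortWord_eq K t (v.drop n) (by simp; omega)
  refine Submodule.mem_iSup_of_mem w (Submodule.mem_mul_span_singleton.2
    ⟨((v.take n).map (FreeAlgebra.ι K)).prod ⊗ₜ b, tmul_mem_tp K
      (Submodule.subset_span ⟨v.take n, by simp; omega, rfl⟩) hb, ?_⟩)
  rw [hw, Algebra.TensorProduct.tmul_mul_tmul, mul_one, ← List.prod_append, ← List.map_append,
    List.take_append_drop]
  rfl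

/-- An element whose left degrees lie in `[n, n + t)` factors through few elements of left
degree exactly `n`. -/
theorem exists_mem_mul (K : Type) [Field K] (t n : ℕ) (V : Submodule K (FA K))
    (c : FA K ⊗[K] FA K) (hc : c ∈ tp K (sumGp K n (n - 1 + t)) V) (hn : 1 ≤ n) :
    ∃ F : Submodule K (FA K ⊗[K] FA K), F ≤ tp K (gp K n) V ∧ FiniteDimensional K F ∧
      Module.finrank K F ≤ t * 2 ^ t ∧ c ∈ F * tp K (sumGp K 0 t) (gp K 0) := by
  have hle : tp K (sumGp K n (n - 1 + t)) V ≤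
      ⨆ w, tp K (gp K n) V * Submodule.span K {shortWord K t w ⊗ₜ[K] (1 : FA K)} := by
    simp only [tp, sumGp, Submodule.map₂_iSup_left, iSup_le_iff, Finset.mem_Icc]
    intro i hi
    obtain ⟨r, rfl⟩ := Nat.exists_eq_add_of_le hi.1
    exact tp_gp_add_le K t n r (by omega) V
  obtain ⟨c', hc', hsum⟩ := (Submodule.mem_iSup_iff_exists_finsupp _ _).1 (hle hc)
  choose h hh hmul using fun w => Submodule.mem_mul_span_singleton.1 (hc' w)
  refine ⟨Submodule.span K (Set.range h), ?_, FiniteDimensional.span_of_finite K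
    (Set.finite_range h), ?_, ?_⟩
  · rw [Submodule.span_le]
    rintro _ ⟨w, rfl⟩
    exact hh w
  · refine (finrank_range_le_card h).trans ?_
    simp
  · rw [← hsum]
    refine Submodule.sum_mem _ fun w _ => ?_
    rw [← hmul w]
    exact Submodule.mul_mem_mul (Submodule.subset_span ⟨w, rfl⟩)
      (tmul_mem_tp K (shortWord_mem K t w) (one_mem_gp_zero K))

theorem sumGp_le_midGp (K : Type) [Field K] {t n k : ℕ} (hk : k ≤ n) (hnk : n ≤ k * t) :
    sumGp K k (k * t) ≤ midGp K t n := by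
  refine sumGp_le K fun i h₁ h₂ => ?_
  refine le_iSup₂_of_le (f := fun i (_ : i ∈ {i : ℕ | n ≤ 2 * t * i ∧ i ≤ 2 * t * n}) => gp K i)
    i ⟨?_, ?_⟩ le_rfl
  · nlinarith [Nat.mul_le_mul_right t h₁]
  · nlinarith [Nat.mul_le_mul_right t hk]

theorem exists_step (K : Type) [Field K] (t n k : ℕ) (hk : k + 1 ≤ n)
    (f p : FA K ⊗[K] FA K) (hf : f ∈ tp K (sumGp K 1 t) (sumGp K 1 t))
    (hp : p ∈ tp K (sumGp K k (min (n - 1) (k * t))) (sumGp K k (k * t))) :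
    ∃ p' ∈ tp K (sumGp K (k + 1) (min (n - 1) ((k + 1) * t))) (sumGp K (k + 1) ((k + 1) * t)),
      ∃ F : Submodule K (FA K ⊗[K] FA K), F ≤ tp K (gp K n) (midGp K t n) ∧
        FiniteDimensional K F ∧ Module.finrank K F ≤ t * 2 ^ t ∧
        p * f - p' ∈ F * tp K (sumGp K 0 t) (gp K 0) := by
  have hkt : (k + 1) * t = k * t + t := by ring
  have hsplit : sumGp K (k + 1) (min (n - 1) (k * t) + t) ≤
      sumGp K (k + 1) (min (n - 1) ((k + 1) * t)) ⊔
        sumGp K n (min (n - 1 + t) ((k + 1) * t)) := by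
    refine sumGp_le K fun i h₁ h₂ => ?_
    by_cases hi : i < n
    · exact (gp_le_sumGp K h₁ (by omega)).trans le_sup_left
    · exact (gp_le_sumGp K (by omega) (by omega)).trans le_sup_right
  have hpf : p * f ∈ tp K (sumGp K (k + 1) (min (n - 1) (k * t) + t))
      (sumGp K (k + 1) ((k + 1) * t)) :=
    tp_mono K (sumGp_mul_sumGp_le K _ _ _ _)
      ((sumGp_mul_sumGp_le K _ _ _ _).trans_eq (by rw [hkt]))
      (tp_mul_tp_le K _ _ _ _ (Submodule.mul_mem_mul hp hf))
  replace hpf := tp_mono K hsplit le_rfl hpf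
  rw [tp, Submodule.map₂_sup_left] at hpf
  obtain ⟨p', hp', c, hc, hpc⟩ := Submodule.mem_sup.1 hpf
  refine ⟨p', hp', ?_⟩
  rw [← hpc, add_sub_cancel_left]
  by_cases hnk : n ≤ (k + 1) * t
  · refine exists_mem_mul K t n _ c (tp_mono K ?_ (sumGp_le_midGp K hk hnk) hc) (by omega)
    exact sumGp_le K fun i h₁ h₂ => gp_le_sumGp K h₁ (h₂.trans (min_le_left _ _))
  · rw [sumGp_eq_bot K (by omega), Submodule.map₂_bot_left, Submodule.mem_bot] at hc
    subst hc
    exact ⟨⊥, bot_le, inferInstance, by simp, Submodule.zero_mem _⟩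

/-- `f ^ k` is, up to a remainder of left degree less than `n`, a combination of terms of left
degree at least `n`, each factored through left degree exactly `n`. -/
theorem exists_pow_sub_mem (K : Type) [Field K] (t n : ℕ) (f : FA K ⊗[K] FA K)
    (hf : f ∈ tp K (sumGp K 1 t) (sumGp K 1 t)) (k : ℕ) (hk : k ≤ n) :
    ∃ p ∈ tp K (sumGp K k (min (n - 1) (k * t))) (sumGp K k (k * t)),
      ∃ F : Submodule K (FA K ⊗[K] FA K), F ≤ tp K (gp K n) (midGp K t n) ∧
        FiniteDimensional K F ∧ Module.finrank K F ≤ k * (t * 2 ^ t) ∧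
        f ^ k - p ∈ F * tp K (sumGp K 0 t) (gp K 0) *
          Subalgebra.toSubmodule (Algebra.adjoin K {f}) := by
  induction k with
  | zero =>
    have h0 : ∀ b, (1 : FA K) ∈ sumGp K 0 b := fun b =>
      gp_le_sumGp K le_rfl (Nat.zero_le b) (one_mem_gp_zero K)
    exact ⟨1, tmul_mem_tp K (h0 _) (h0 _), ⊥, bot_le, inferInstance, by simp, by simp⟩
  | succ k ih =>
    obtain ⟨p, hp, F, hF, hFfd, hFrank, hmem⟩ := ih (by omega)
    obtain ⟨p', hp', F', hF', hFfd', hFrank', hmem'⟩ := exists_step K t n k hk f p hf hp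
    refine ⟨p', hp', F ⊔ F', sup_le hF hF', inferInstance, ?_, ?_⟩
    · have := Submodule.finrank_add_le_finrank_add_finrank F F'
      rw [add_one_mul]
      omega
    · have hsplit : f ^ (k + 1) - p' = (f ^ k - p) * f + (p * f - p') * 1 := by
        rw [pow_succ, sub_mul, mul_one, sub_add_sub_cancel]
      have hfmem : f ∈ Subalgebra.toSubmodule (Algebra.adjoin K {f}) :=
        Algebra.self_mem_adjoin_singleton K f
      rw [hsplit]
      refine Submodule.add_mem _ ?_ ?_
      · have := Submodule.mul_mem_mul hmem hfmem
        rw [mul_assoc _ (Subalgebra.toSubmodule _),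
          (Subalgebra.isIdempotentElem_toSubmodule _).eq] at this
        exact SetLike.le_def.1 (mul_le_mul_left (mul_le_mul_left le_sup_left _) _) this
      · exact Submodule.mul_mem_mul (SetLike.le_def.1 (mul_le_mul_left le_sup_right _) hmem')
          (Subalgebra.one_mem _)

theorem statement10 (K : Type) [Field K] (t : ℕ) (ht : 1 ≤ t)
    (f : FA K ⊗[K] FA K)
    (hf : f ∈ ⨆ i ∈ Finset.Icc 1 t, ⨆ j ∈ Finset.Icc 1 t, tp K (gp K i) (gp K j))
    (n : ℕ) (hn : t < n) :
    ∃ F : Submodule K (FA K ⊗[K] FA K),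
      F ≤ tp K (gp K n) (midGp K t n) ∧
      FiniteDimensional K F ∧
      Module.finrank K F ≤ 2 ^ (2 * t + 1) * t * n ∧
      ∀ m : ℕ, n ≤ m →
        f ^ m ∈ rIdeal K
          {z | ∃ h ∈ F, ∃ g ∈ tp K (sumGp K 0 t) (gp K 0), z = h * g * f ^ (m - n)} := by
  have hf' : f ∈ tp K (sumGp K 1 t) (sumGp K 1 t) := by
    refine (iSup₂_le fun i hi => iSup₂_le fun j hj => ?_ :
      (⨆ i ∈ Finset.Icc 1 t, ⨆ j ∈ Finset.Icc 1 t, tp K (gp K i) (gp K j)) ≤ _) hf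
    rw [Finset.mem_Icc] at hi hj
    exact tp_mono K (gp_le_sumGp K hi.1 hi.2) (gp_le_sumGp K hj.1 hj.2)
  obtain ⟨p, hp, F, hF, hFfd, hFrank, hmem⟩ := exists_pow_sub_mem K t n f hf' n le_rfl
  rw [sumGp_eq_bot K (lo := n) (by omega), tp, Submodule.map₂_bot_left, Submodule.mem_bot] at hp
  rw [hp, sub_zero] at hmem
  refine ⟨F, hF, hFfd, hFrank.trans ?_, fun m hm => ?_⟩
  · calc n * (t * 2 ^ t) = 2 ^ t * (t * n) := by ring
      _ ≤ 2 ^ (2 * t + 1) * (t * n) :=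
        Nat.mul_le_mul_right _ (Nat.pow_le_pow_right (by norm_num) (by omega))
      _ = 2 ^ (2 * t + 1) * t * n := by ring
  · have hpow : f ^ m = f ^ n * f ^ (m - n) := by rw [← pow_add, Nat.add_sub_cancel' hm]
    rw [hpow]
    refine Submodule.mul_induction_on hmem (fun x hx a ha => ?_) fun x y hx hy => ?_
    · have hcomm : a * f ^ (m - n) = f ^ (m - n) * a :=
        congrArg Subtype.val (mul_comm (⟨a, ha⟩ : Algebra.adjoin K {f})
          (⟨f, Algebra.self_mem_adjoin_singleton K f⟩ ^ (m - n)))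
      rw [mul_assoc, hcomm, ← mul_assoc]
      refine Submodule.mul_mem_mul ?_ Submodule.mem_top
      refine Submodule.mul_induction_on hx (fun h hh g hg => ?_) fun x y hx hy => ?_
      · exact Submodule.subset_span ⟨h, hh, g, hg, rfl⟩
      · rw [add_mul]
        exact Submodule.add_mem _ hx hy
    · rw [add_mul]
      exact Submodule.add_mem _ hx hy
end
end

section
/- Let n ≥ 1 be a natural number and let D be a finite-dimensional K-subspace of A ⊗ (∑_{i≥1} A(n+i)) ⊆ A ⊗_K A. Then there exist K-subspaces Z and Z̄ of A ⊗_K A with dim_K Z ≤ 2^n·dim_K D and dim_K Z̄ ≤ 2^n·dim_K D such that D ⊆ Z·(K·1 ⊗ A(n)) and D ⊆ (K·1 ⊗ A(n))·Z̄. -/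
open TensorProduct

noncomputable section

open Module in
/-- A finite-dimensional subspace of a sum of ranges of finitely many linear maps is already
covered by the images of a subspace of controlled dimension. -/
theorem exists_finrank_le_iSup_map {K M N ι : Type*} [Field K] [AddCommGroup M] [Module K M]
    [AddCommGroup N] [Module K N] [Fintype ι] (φ : ι → M →ₗ[K] N) (D : Submodule K N)
    [FiniteDimensional K D] (hD : D ≤ ⨆ i, LinearMap.range (φ i)) :
    ∃ Z : Submodule K M, FiniteDimensional K Z ∧ finrank K Z ≤ Fintype.card ι * finrank K D ∧
      D ≤ ⨆ i, Z.map (φ i) := by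
  have key : ∀ d ∈ D, ∃ z : ι → M, ∑ i, φ i (z i) = d := by
    intro d hd
    obtain ⟨f, hf, rfl⟩ := (Submodule.mem_iSup_iff_exists_finsupp _ _).1 (hD hd)
    choose z hz using hf
    exact ⟨z, by simp [hz, Finsupp.sum_fintype]⟩
  choose! z hz using key
  let b := finBasis K D
  let g : ι × Fin (finrank K D) → M := fun p => z (b p.2) p.1
  refine ⟨Submodule.span K (Set.range g), FiniteDimensional.span_of_finite K (Set.finite_range g),
    (finrank_range_le_card g).trans (by simp), ?_⟩
  have hb : D = Submodule.span K (Set.range fun j => (b j : N)) := by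
    have h := congrArg (Submodule.map D.subtype) b.span_eq
    rw [Submodule.map_span, Submodule.map_top, Submodule.range_subtype, ← Set.range_comp] at h
    exact h.symm
  conv_lhs => rw [hb]
  rw [Submodule.span_le]
  rintro _ ⟨j, rfl⟩
  beta_reduce
  rw [← hz (b j) (b j).2]
  exact Submodule.sum_mem _ fun i _ => Submodule.mem_iSup_of_mem i
    (Submodule.mem_map_of_mem (Submodule.subset_span ⟨(i, j), rfl⟩))

/-- The monomial of `A` spelled by the word `w`. -/
def wordProd (K : Type) [Field K] (w : List (Fin 2)) : FA K := (w.map (FreeAlgebra.ι K)).prod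

theorem wordProd_append (K : Type) [Field K] (u v : List (Fin 2)) :
    wordProd K (u ++ v) = wordProd K u * wordProd K v := by
  simp [wordProd]

theorem one_tmul_wordProd_mem (K : Type) [Field K] {n : ℕ} (w : Fin n → Fin 2) :
    (1 : FA K) ⊗ₜ[K] wordProd K (List.ofFn w) ∈ tp K (gp K 0) (gp K n) :=
  Submodule.apply_mem_map₂ _ (Submodule.subset_span ⟨[], rfl, by simp⟩)
    (Submodule.subset_span ⟨List.ofFn w, by simp, rfl⟩)

/-- To bound `A ⊗ ∑ A(n + i + 1)` it suffices to treat tensors ending in a monomial. -/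
theorem tp_top_iSup_gp_le (K : Type) [Field K] (n : ℕ) (S : Submodule K (FA K ⊗[K] FA K))
    (hS : ∀ (a : FA K) (w : List (Fin 2)), n ≤ w.length → a ⊗ₜ[K] wordProd K w ∈ S) :
    tp K ⊤ (⨆ i : ℕ, gp K (n + i + 1)) ≤ S := by
  refine Submodule.map₂_le.2 fun a _ b hb => ?_
  have h : (⨆ i : ℕ, gp K (n + i + 1)) ≤ S.comap (TensorProduct.mk K (FA K) (FA K) a) := by
    refine iSup_le fun i => Submodule.span_le.2 ?_
    rintro _ ⟨w, hw, rfl⟩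
    exact hS a w (by omega)
  exact h hb

theorem exists_ofFn_eq {α : Type*} {n : ℕ} {w : List α} (hw : w.length = n) :
    ∃ v : Fin n → α, List.ofFn v = w := by
  subst hw
  exact ⟨w.get, List.ofFn_get w⟩

theorem tp_top_le_iSup_range_mulRight (K : Type) [Field K] (n : ℕ) :
    tp K ⊤ (⨆ i : ℕ, gp K (n + i + 1)) ≤ ⨆ v : Fin n → Fin 2, LinearMap.range
      (LinearMap.mulRight K ((1 : FA K) ⊗ₜ[K] wordProd K (List.ofFn v))) := by
  refine tp_top_iSup_gp_le K n _ fun a w hw => ?_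
  obtain ⟨v, hv⟩ := exists_ofFn_eq (w := w.drop (w.length - n)) (n := n) (by simp; omega)
  refine Submodule.mem_iSup_of_mem v ⟨a ⊗ₜ wordProd K (w.take (w.length - n)), ?_⟩
  rw [LinearMap.mulRight_apply, Algebra.TensorProduct.tmul_mul_tmul, hv, ← wordProd_append,
    List.take_append_drop, mul_one]

theorem tp_top_le_iSup_range_mulLeft (K : Type) [Field K] (n : ℕ) :
    tp K ⊤ (⨆ i : ℕ, gp K (n + i + 1)) ≤ ⨆ v : Fin n → Fin 2, LinearMap.range
      (LinearMap.mulLeft K ((1 : FA K) ⊗ₜ[K] wordProd K (List.ofFn v))) := by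
  refine tp_top_iSup_gp_le K n _ fun a w hw => ?_
  obtain ⟨v, hv⟩ := exists_ofFn_eq (w := w.take n) (n := n) (by simpa using hw)
  refine Submodule.mem_iSup_of_mem v ⟨a ⊗ₜ wordProd K (w.drop n), ?_⟩
  rw [LinearMap.mulLeft_apply, Algebra.TensorProduct.tmul_mul_tmul, hv, ← wordProd_append,
    List.take_append_drop, one_mul]

theorem statement16 (K : Type) [Field K] (n : ℕ) (hn : 1 ≤ n)
    (D : Submodule K (FA K ⊗[K] FA K))
    (hD : D ≤ tp K ⊤ (⨆ i : ℕ, gp K (n + i + 1)))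
    (hDfin : FiniteDimensional K D) :
    ∃ Z Zbar : Submodule K (FA K ⊗[K] FA K),
      FiniteDimensional K Z ∧
      FiniteDimensional K Zbar ∧
      Module.finrank K Z ≤ 2 ^ n * Module.finrank K D ∧
      Module.finrank K Zbar ≤ 2 ^ n * Module.finrank K D ∧
      D ≤ Z * tp K (gp K 0) (gp K n) ∧
      D ≤ tp K (gp K 0) (gp K n) * Zbar := by
  obtain ⟨Z, hZ, hZr, hDZ⟩ := exists_finrank_le_iSup_map _ D
    (hD.trans (tp_top_le_iSup_range_mulRight K n))
  obtain ⟨Y, hY, hYr, hDY⟩ := exists_finrank_le_iSup_map _ D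
    (hD.trans (tp_top_le_iSup_range_mulLeft K n))
  refine ⟨Z, Y, hZ, hY, by simpa using hZr, by simpa using hYr,
    hDZ.trans (iSup_le fun v => ?_), hDY.trans (iSup_le fun v => ?_)⟩
  · rintro _ ⟨z, hz, rfl⟩
    exact Submodule.mul_mem_mul hz (one_tmul_wordProd_mem K v)
  · rintro _ ⟨z, hz, rfl⟩
    exact Submodule.mul_mem_mul (one_tmul_wordProd_mem K v) hz
end
end
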